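/- Let k be a field of characteristic 0 and let k(z) denote the field of rational functions in one variable over k. For each n ∈ {0, 1, 2, 3, 5, 7, 9, 15, 27} there exists a nonzero homogeneous polynomial f of degree 3 in four variables over k(z) defining a smooth cubic surface such that the set of lines on V(f) defined over k(z) has exactly n elements. -/

import Mathlib

open MvPolynomial

/-- The restriction of `f` to the line spanned by `v` and `w`:
the polynomial `f (s • v + t • w)` in the two variables `s, t`. -/
noncomputable def lineRestrict {k : Type*} [CommRing k] (f : MvPolynomial (Fin 4) k)
    (v w : Fin 4 → k) : MvPolynomial (Fin 2) k :=
  aeval (fun i => C (v i) * X 0 + C (w i) * X 1) f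

/-- `W` is a line on the cubic surface `V(f)` defined over `k`: a 2-dimensional
`k`-linear subspace of `k⁴` on which `f` vanishes identically as a polynomial. -/
def IsLineOn {k : Type*} [Field k] (f : MvPolynomial (Fin 4) k)
    (W : Submodule k (Fin 4 → k)) : Prop :=
  Module.finrank k W = 2 ∧
    ∃ v w : Fin 4 → k, Submodule.span k {v, w} = W ∧ lineRestrict f v w = 0

/-- `f` defines a smooth cubic surface over `k`: `f` is a nonzero homogeneous cubic
and, over an algebraic closure, the only common zero of `f` and its partial
derivatives is the origin. -/
def IsSmoothCubic (k : Type*) [Field k] (f : MvPolynomial (Fin 4) k) : Prop :=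
  f ≠ 0 ∧ f.IsHomogeneous 3 ∧
    ∀ x : Fin 4 → AlgebraicClosure k,
      (eval x (map (algebraMap k (AlgebraicClosure k)) f) = 0 ∧
        ∀ i : Fin 4, eval x (map (algebraMap k (AlgebraicClosure k)) (pderiv i f)) = 0) →
      x = 0

theorem isLineOn_iff {K : Type*} [Field K] [Infinite K] (f : MvPolynomial (Fin 4) K)
    (W : Submodule K (Fin 4 → K)) :
    IsLineOn f W ↔ Module.finrank K W = 2 ∧ ∀ v ∈ W, eval v f = 0 := by
  have key : ∀ (v w : Fin 4 → K) (x : Fin 2 → K),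
      eval x (lineRestrict f v w) = eval (x 0 • v + x 1 • w) f := by
    intro v w x
    have : (eval x).comp (aeval (fun i => C (v i) * X 0 + C (w i) * X 1 :
        Fin 4 → MvPolynomial (Fin 2) K) : MvPolynomial (Fin 4) K →ₐ[K] _).toRingHom =
        eval (x 0 • v + x 1 • w) := by
      ext i
      · simp
      · simp [mul_comm]
    exact DFunLike.congr_fun this f
  refine and_congr_right fun hW => ⟨?_, fun h => ?_⟩
  · rintro ⟨v, w, rfl, h⟩ p hp
    obtain ⟨a, b, rfl⟩ := Submodule.mem_span_pair.1 hp
    simpa [h] using (key v w ![a, b]).symm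
  · let b := Module.finBasisOfFinrankEq K W hW
    have hb : Submodule.span K {(b 0 : Fin 4 → K), (b 1 : Fin 4 → K)} = W := by
      have := congrArg (Submodule.map W.subtype) b.span_eq
      rw [Submodule.map_span, Submodule.map_top, Submodule.range_subtype] at this
      refine Eq.trans ?_ this
      congr 1
      ext x
      simp [Fin.exists_fin_two, eq_comm]
    refine ⟨b 0, b 1, hb, MvPolynomial.funext fun x => ?_⟩
    rw [key, (eval x).map_zero]
    exact h _ (W.add_mem (W.smul_mem _ (b 0).2) (W.smul_mem _ (b 1).2))

theorem isHomogeneous_cubicTerm {K : Type*} [CommRing K] (a : K) (i j l : Fin 4) :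
    (C a * X i * X j * X l : MvPolynomial (Fin 4) K).IsHomogeneous 3 :=
  (((isHomogeneous_C _ a).mul (isHomogeneous_X K i)).mul (isHomogeneous_X K j)).mul
    (isHomogeneous_X K l)

/-- A two-dimensional subspace either meets a coordinate subspace of codimension two nontrivially,
or is a graph over the corresponding coordinate plane. -/
theorem exists_ne_zero_or_exists_graph {K : Type*} [Field K] {W : Submodule K (Fin 4 → K)}
    (hW : Module.finrank K W = 2) (m n : Fin 4) :
    (∃ p ∈ W, p ≠ 0 ∧ p m = 0 ∧ p n = 0) ∨
      ∃ u ∈ W, ∃ v ∈ W, u m = 1 ∧ u n = 0 ∧ v m = 0 ∧ v n = 1 := by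
  let φ : W →ₗ[K] K × K :=
    ((LinearMap.proj m).prod (LinearMap.proj n)).comp W.subtype
  by_cases h : Function.Injective φ
  · right
    have hs : Function.Surjective φ :=
      (LinearMap.injective_iff_surjective_of_finrank_eq_finrank (by simp [hW])).1 h
    obtain ⟨u, hu⟩ := hs (1, 0)
    obtain ⟨v, hv⟩ := hs (0, 1)
    exact ⟨u, u.2, v, v.2, congrArg Prod.fst hu, congrArg Prod.snd hu, congrArg Prod.fst hv,
      congrArg Prod.snd hv⟩
  · left
    rw [← LinearMap.ker_eq_bot, Submodule.eq_bot_iff] at h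
    push Not at h
    obtain ⟨p, hp, hp0⟩ := h
    have hp' : φ p = (0, 0) := hp
    exact ⟨p, p.2, by simpa using hp0, congrArg Prod.fst hp', congrArg Prod.snd hp'⟩

theorem exists_ne_zero_apply_eq_zero {K : Type*} [Field K] {W : Submodule K (Fin 4 → K)}
    (hW : Module.finrank K W = 2) (m : Fin 4) : ∃ p ∈ W, p ≠ 0 ∧ p m = 0 := by
  rcases exists_ne_zero_or_exists_graph hW m m with ⟨p, hp, h0, h, -⟩ | ⟨u, -, -, -, h, h', -⟩
  · exact ⟨p, hp, h0, h⟩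
  · exact absurd (h.symm.trans h') one_ne_zero

theorem finrank_eq_two {K : Type*} [Field K] {U : Submodule K (Fin 4 → K)} (m n : Fin 4)
    {u v : Fin 4 → K} (hu : u ∈ U) (hv : v ∈ U) (hum : u m = 1) (hun : u n = 0)
    (hvm : v m = 0) (hvn : v n = 1) (h : ∀ p ∈ U, p m = 0 → p n = 0 → p = 0) :
    Module.finrank K U = 2 := by
  let φ : U →ₗ[K] K × K :=
    ((LinearMap.proj m).prod (LinearMap.proj n)).comp U.subtype
  have hφ : ∀ p, φ p = (p.1 m, p.1 n) := fun _ => rfl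
  have hb : Function.Bijective φ := by
    refine ⟨?_, fun x => ⟨x.1 • ⟨u, hu⟩ + x.2 • ⟨v, hv⟩, by simp [*]⟩⟩
    rw [← LinearMap.ker_eq_bot, Submodule.eq_bot_iff]
    intro p hp
    have hp' : φ p = (0, 0) := hp
    rw [hφ, Prod.mk.injEq] at hp'
    exact Subtype.ext (h p p.2 hp'.1 hp'.2)
  simpa using (LinearEquiv.ofBijective φ hb).finrank_eq

/-- There is a smooth cubic surface over `K` with exactly `n` lines defined over `K`. -/
def HasLineCount (K : Type*) [Field K] (n : ℕ) : Prop :=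
  ∃ f : MvPolynomial (Fin 4) K, IsSmoothCubic K f ∧
    {W : Submodule K (Fin 4 → K) | IsLineOn f W}.Finite ∧
    {W : Submodule K (Fin 4 → K) | IsLineOn f W}.ncard = n

theorem hasLineCount_of_finset {K : Type*} [Field K] [Infinite K] {f : MvPolynomial (Fin 4) K}
    (hf : IsSmoothCubic K f) (s : Finset (Submodule K (Fin 4 → K)))
    (hs : ∀ W, W ∈ s ↔ Module.finrank K W = 2 ∧ ∀ v ∈ W, eval v f = 0) :
    HasLineCount K s.card := by
  have h : {W : Submodule K (Fin 4 → K) | IsLineOn f W} = s := by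
    ext W
    rw [Set.mem_ofPred_eq, isLineOn_iff, Finset.mem_coe, hs]
  exact ⟨f, hf, h ▸ s.finite_toSet, by rw [h, Set.ncard_coe_finset]⟩

theorem hasLineCount_zero {K : Type*} [Field K] [CharZero K] {T : K}
    (hT : ∀ x y z : K, x ^ 3 + T * y ^ 3 + T ^ 2 * z ^ 3 = 0 → x = 0 ∧ y = 0 ∧ z = 0) :
    HasLineCount K 0 := by
  have hT0 : T ≠ 0 := by
    rintro rfl
    simpa using hT 0 1 0
  have hT0' : algebraMap K (AlgebraicClosure K) T ≠ 0 := by simpa using hT0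
  have : CharZero (AlgebraicClosure K) := algebraRat.charZero _
  let f : MvPolynomial (Fin 4) K := C 1 * X 0 * X 0 * X 0 + C T * X 1 * X 1 * X 1 +
    C (T ^ 2) * X 2 * X 2 * X 2 + C 1 * X 3 * X 3 * X 3
  have hf (v : Fin 4 → K) :
      eval v f = v 0 ^ 3 + T * v 1 ^ 3 + T ^ 2 * v 2 ^ 3 + v 3 ^ 3 := by
    simp only [f, map_add, map_mul, eval_X, eval_C]
    ring
  refine hasLineCount_of_finset (f := f) ⟨fun h => ?_, ?_, fun x ⟨_, hx⟩ => ?_⟩ ∅ fun W => ?_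
  · simpa [h] using hf ![1, 0, 0, 0]
  · exact (((isHomogeneous_cubicTerm _ _ _ _).add (isHomogeneous_cubicTerm _ _ _ _)).add
      (isHomogeneous_cubicTerm _ _ _ _)).add (isHomogeneous_cubicTerm _ _ _ _)
  · simp [f, Fin.forall_fin_succ] at hx
    ext i
    fin_cases i <;> simp <;> grind
  · simp only [Finset.notMem_empty, false_iff, not_and, not_forall, hf]
    intro hW
    by_contra! h
    obtain ⟨p, hp, hp0, h3⟩ := exists_ne_zero_apply_eq_zero hW 3
    obtain ⟨h0, h1, h2⟩ := hT (p 0) (p 1) (p 2) (by simpa [h3] using h p hp)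
    refine hp0 (funext fun i => ?_)
    fin_cases i <;> assumption

/-- The line on which the coordinates `m` and `n` vanish. -/
def coordLine (K : Type*) [Field K] (m n : Fin 4) : Submodule K (Fin 4 → K) :=
  LinearMap.ker (LinearMap.proj m : (Fin 4 → K) →ₗ[K] K) ⊓
    LinearMap.ker (LinearMap.proj n : (Fin 4 → K) →ₗ[K] K)

theorem mem_coordLine {K : Type*} [Field K] {m n : Fin 4} {v : Fin 4 → K} :
    v ∈ coordLine K m n ↔ v m = 0 ∧ v n = 0 :=
  Iff.rfl

theorem finrank_coordLine (K : Type*) [Field K] {m n m' n' : Fin 4}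
    (h : [m, n, m', n'].Nodup) : Module.finrank K (coordLine K m n) = 2 := by
  have hc : ∀ i, i = m ∨ i = n ∨ i = m' ∨ i = n' := by
    revert m n m' n'
    decide
  simp only [List.nodup_cons, List.mem_cons, List.not_mem_nil, not_or] at h
  refine finrank_eq_two (u := Pi.single m' 1) (v := Pi.single n' 1) m' n' ?_ ?_ ?_ ?_ ?_ ?_ ?_
  any_goals simp [mem_coordLine, h, eq_comm]
  intro p hm hn hm' hn'
  ext i
  rcases hc i with rfl | rfl | rfl | rfl <;> simpa

theorem hasLineCount_one {K : Type*} [Field K] [CharZero K] {t u : K}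
    (ht : ¬ IsSquare t) (hu : ¬ IsSquare u) (htu : ¬ IsSquare (t * u)) :
    HasLineCount K 1 := by
  have ht0 : algebraMap K (AlgebraicClosure K) t ≠ 0 := by
    rw [Ne, FaithfulSMul.algebraMap_eq_zero_iff]
    rintro rfl
    simp at ht
  have hu0 : algebraMap K (AlgebraicClosure K) u ≠ 0 := by
    rw [Ne, FaithfulSMul.algebraMap_eq_zero_iff]
    rintro rfl
    simp at hu
  have hsq {r x y : K} (hr : ¬ IsSquare r) (h : x ^ 2 = r * y ^ 2) : x = 0 ∧ y = 0 := by
    have hy : y = 0 := by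
      by_contra hy
      exact hr ⟨x / y, by field_simp; exact h.symm⟩
    simpa [hy] using h
  have : CharZero (AlgebraicClosure K) := algebraRat.charZero _
  let f : MvPolynomial (Fin 4) K := C 1 * X 0 * X 0 * X 0 + C (-t) * X 0 * X 1 * X 1 +
    C 1 * X 2 * X 2 * X 2 + C (-u) * X 2 * X 3 * X 3
  have hf (v : Fin 4 → K) :
      eval v f = v 0 * (v 0 ^ 2 - t * v 1 ^ 2) + v 2 * (v 2 ^ 2 - u * v 3 ^ 2) := by
    simp only [f, map_add, map_mul, eval_X, eval_C]
    ring
  have hf1 : IsSmoothCubic K f := by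
    refine ⟨fun h => ?_, ?_, fun x ⟨_, hx⟩ => ?_⟩
    · simpa [h] using hf ![1, 0, 0, 0]
    · exact (((isHomogeneous_cubicTerm _ _ _ _).add (isHomogeneous_cubicTerm _ _ _ _)).add
        (isHomogeneous_cubicTerm _ _ _ _)).add (isHomogeneous_cubicTerm _ _ _ _)
    · simp [f, Fin.forall_fin_succ] at hx
      ext i
      fin_cases i <;> simp <;> grind
  refine hasLineCount_of_finset hf1 {coordLine K 0 2} fun W => ?_
  have hL : Module.finrank K (coordLine K 0 2) = 2 :=
    finrank_coordLine K (m' := 1) (n' := 3) (by decide)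
  rw [Finset.mem_singleton]
  refine ⟨?_, fun ⟨hW, h⟩ => ?_⟩
  · rintro rfl
    refine ⟨hL, fun v ⟨h0, h2⟩ => ?_⟩
    rw [hf, show v 0 = 0 from h0, show v 2 = 0 from h2]
    ring
  simp only [hf] at h
  have hu' : u ≠ 0 := by rintro rfl; simp at hu
  have ht' : t ≠ 0 := by rintro rfl; simp at ht
  rcases exists_ne_zero_or_exists_graph hW 0 1 with
    ⟨p, hp, hp0, h0, h1⟩ | ⟨v, hv, w, hw, v0, v1, w0, w1⟩
  · have hp2 : p 2 = 0 := by
      by_contra hp2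
      have hp' := h p hp
      simp only [h0, zero_mul, zero_add, mul_eq_zero, hp2, false_or, sub_eq_zero] at hp'
      exact hp2 (hsq hu hp').1
    have hp3 : p 3 ≠ 0 := fun h3 => hp0 (by ext i; fin_cases i <;> assumption)
    refine Submodule.eq_of_le_of_finrank_eq (fun q hq => ?_) (hW.trans hL.symm)
    have e0 := h q hq
    have e1 := h _ (W.add_mem hq hp)
    have e2 := h _ (W.sub_mem hq hp)
    simp only [Pi.add_apply, Pi.sub_apply, h0, h1, hp2, add_zero, sub_zero] at e1 e2
    have h2 : q 2 = 0 := by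
      have : u * p 3 ^ 2 * q 2 = 0 := by linear_combination e0 - e1 / 2 - e2 / 2
      simpa [hu', hp3] using this
    refine ⟨?_, h2⟩
    by_contra h0
    simp only [h2, zero_mul, add_zero, mul_eq_zero, sub_eq_zero] at e0
    exact h0 (hsq ht (e0.resolve_left h0)).1
  · exfalso
    have e0 := h v hv
    have e1 := h w hw
    have e2 := h _ (W.add_mem hv hw)
    have e3 := h _ (W.sub_mem hv hw)
    simp only [Pi.add_apply, Pi.sub_apply, v0, v1, w0, w1] at e0 e1 e2 e3
    have hw2 : w 2 = 0 := by
      by_contra hw2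
      simp only [zero_mul, zero_add, mul_eq_zero, hw2, false_or, sub_eq_zero] at e1
      exact hw2 (hsq hu e1).1
    simp only [hw2, add_zero, sub_zero] at e2 e3
    have hd : t + v 2 * u * w 3 ^ 2 = 0 := by linear_combination e0 - e2 / 2 - e3 / 2
    have hc : v 2 * u * w 3 * v 3 = 0 := by linear_combination (e3 - e2) / 4
    have hvw : v 2 * u * w 3 ≠ 0 := fun h => ht' (by linear_combination hd - w 3 * h)
    have hv3 : v 3 = 0 := by simpa [hvw] using hc
    refine htu ⟨v 2 ^ 2 * u * w 3, ?_⟩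
    simp only [hv3] at e0
    linear_combination u * hd - v 2 * u ^ 2 * w 3 ^ 2 * e0

theorem hasLineCount_two {K : Type*} [Field K] [CharZero K] {T : K} (hT0 : T ≠ 0)
    (hT : ∀ x : K, x ^ 5 ≠ T) : HasLineCount K 2 := by
  have hT0' : algebraMap K (AlgebraicClosure K) T ≠ 0 := by simpa using hT0
  have : CharZero (AlgebraicClosure K) := algebraRat.charZero _
  let f : MvPolynomial (Fin 4) K := C 1 * X 1 * X 1 * X 2 + C 1 * X 2 * X 2 * X 0 +
    C (-1) * X 0 * X 0 * X 3 + C (-T) * X 3 * X 3 * X 1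
  have hf (v : Fin 4 → K) :
      eval v f = v 1 ^ 2 * v 2 + v 2 ^ 2 * v 0 - v 0 ^ 2 * v 3 - T * v 3 ^ 2 * v 1 := by
    simp only [f, map_add, map_mul, eval_X, eval_C]
    ring
  have hf1 : IsSmoothCubic K f := by
    refine ⟨fun h => ?_, ?_, fun x ⟨_, hx⟩ => ?_⟩
    · simpa [h] using hf ![1, 0, 0, 1]
    · exact (((isHomogeneous_cubicTerm _ _ _ _).add (isHomogeneous_cubicTerm _ _ _ _)).add
        (isHomogeneous_cubicTerm _ _ _ _)).add (isHomogeneous_cubicTerm _ _ _ _)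
    · simp [f, Fin.forall_fin_succ] at hx
      set τ := algebraMap K (AlgebraicClosure K) T
      obtain ⟨h0, h1, h2, h3⟩ := hx
      have e0 : x 2 ^ 2 = 2 * x 0 * x 3 := by linear_combination h0
      have e1 : τ * x 3 ^ 2 = 2 * x 1 * x 2 := by linear_combination -h1
      have e2 : x 1 ^ 2 = -2 * x 2 * x 0 := by linear_combination h2
      have e3 : x 0 ^ 2 = -2 * τ * x 3 * x 1 := by linear_combination -h3
      have e : τ * (x 0 * x 1 * x 2 * x 3) ^ 2 = 0 := by
        have : x 2 ^ 2 * (τ * x 3 ^ 2) * x 1 ^ 2 * x 0 ^ 2 =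
            2 * x 0 * x 3 * (2 * x 1 * x 2) * (-2 * x 2 * x 0) * (-2 * τ * x 3 * x 1) := by
          rw [e0, e1, e2, e3]
        linear_combination -this / 15
      simp only [mul_eq_zero, hT0', false_or, ne_eq, OfNat.ofNat_ne_zero, not_false_eq_true,
        pow_eq_zero_iff] at e
      ext i
      fin_cases i <;> simp <;> grind
  have hL1 : Module.finrank K (coordLine K 0 1) = 2 :=
    finrank_coordLine K (m' := 2) (n' := 3) (by decide)
  have hL2 : Module.finrank K (coordLine K 2 3) = 2 :=
    finrank_coordLine K (m' := 0) (n' := 1) (by decide)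
  have hne : coordLine K 0 1 ≠ coordLine K 2 3 := by
    intro h
    have : Pi.single 2 1 ∈ coordLine K 2 3 := h ▸ (show _ ∈ coordLine K 0 1 by simp [mem_coordLine])
    simp [mem_coordLine] at this
  have := Classical.decEq (Submodule K (Fin 4 → K))
  rw [← Finset.card_pair hne]
  refine hasLineCount_of_finset hf1 _ fun W => ?_
  rw [Finset.mem_insert, Finset.mem_singleton]
  refine ⟨?_, fun ⟨hW, h⟩ => ?_⟩
  · rintro (rfl | rfl)
    · refine ⟨hL1, fun v ⟨h0, h1⟩ => ?_⟩
      rw [hf, show v 0 = 0 from h0, show v 1 = 0 from h1]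
      ring
    · refine ⟨hL2, fun v ⟨h0, h1⟩ => ?_⟩
      rw [hf, show v 2 = 0 from h0, show v 3 = 0 from h1]
      ring
  simp only [hf] at h
  rcases exists_ne_zero_or_exists_graph hW 0 1 with
    ⟨p, hp, hp0, h0, h1⟩ | ⟨v, hv, w, hw, v0, v1, w0, w1⟩
  · left
    have key : ∀ q ∈ W, p 2 ^ 2 * q 0 = T * p 3 ^ 2 * q 1 ∧
        q 1 ^ 2 * p 2 + 2 * q 2 * q 0 * p 2 - q 0 ^ 2 * p 3 - 2 * T * q 3 * p 3 * q 1 = 0 := by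
      intro q hq
      have e0 := h q hq
      have e1 := h _ (W.add_mem hq hp)
      have e2 := h _ (W.sub_mem hq hp)
      simp only [Pi.add_apply, Pi.sub_apply, h0, h1, add_zero, sub_zero] at e1 e2
      exact ⟨by linear_combination e1 / 2 + e2 / 2 - e0, by linear_combination e1 / 2 - e2 / 2⟩
    refine Submodule.eq_of_le_of_finrank_eq (fun q hq => ?_) (hW.trans hL1.symm)
    rw [mem_coordLine]
    by_cases h2 : p 2 = 0
    · have h3 : p 3 ≠ 0 := fun h3 => hp0 (by ext i; fin_cases i <;> assumption)
      obtain ⟨a1, a2⟩ := key q hq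
      have q1 : q 1 = 0 := by simpa [h2, hT0, h3] using a1.symm
      exact ⟨by simpa [h2, q1, h3] using a2, q1⟩
    · have hr : q - (q 2 / p 2) • p ∈ W := W.sub_mem hq (W.smul_mem _ hp)
      obtain ⟨a1, a2⟩ := key _ hr
      have a0 := h _ hr
      simp only [Pi.sub_apply, Pi.smul_apply, smul_eq_mul, h0, h1, mul_zero, sub_zero,
        div_mul_cancel₀ _ h2, sub_self] at a0 a1 a2
      generalize q 3 - q 2 / p 2 * p 3 = r at a0 a1 a2
      have q1 : q 1 = 0 := by
        by_contra q1
        have h3 : p 3 ≠ 0 := by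
          intro h3
          have q0 : q 0 = 0 := by simpa [h3, h2] using a1
          simp [h3, q0, q1, h2] at a2
        obtain ⟨s, hs'⟩ : ∃ s, s ^ 5 = T ^ 2 := by
          by_cases hr0 : r = 0
          · refine ⟨p 2 / p 3, ?_⟩
            field_simp
            refine mul_left_cancel₀ (pow_ne_zero 2 q1) ?_
            simp only [hr0] at a2
            linear_combination p 2 ^ 4 * a2 + p 3 * (p 2 ^ 2 * q 0 + T * p 3 ^ 2 * q 1) * a1
          · refine ⟨-(p 2 / p 3), ?_⟩
            have a3 : q 0 ^ 2 + T * r * q 1 = 0 :=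
              mul_left_cancel₀ hr0 (by linear_combination -a0)
            field_simp
            refine mul_left_cancel₀ (pow_ne_zero 2 q1) ?_
            linear_combination -p 2 ^ 4 * (a2 + 2 * p 3 * a3) +
              p 3 * (p 2 ^ 2 * q 0 + T * p 3 ^ 2 * q 1) * a1
        refine hT (s ^ 3 / T) ?_
        field_simp
        linear_combination (s ^ 10 + s ^ 5 * T ^ 2 + T ^ 4) * hs'
      exact ⟨by simpa [q1, h2] using a1, q1⟩
  · right
    symm
    refine Submodule.eq_of_le_of_finrank_eq (fun q hq => ?_) (hL2.trans hW.symm)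
    have e0 := h v hv
    have e1 := h w hw
    have e2 := h _ (W.add_mem hv hw)
    have e3 := h _ (W.sub_mem hv hw)
    simp only [Pi.add_apply, Pi.sub_apply, v0, v1, w0, w1] at e0 e1 e2 e3
    have f0 : v 3 = v 2 ^ 2 := by linear_combination -e0
    have f1 : w 2 = T * w 3 ^ 2 := by linear_combination e1
    have f2 : 2 * v 2 * w 2 - w 3 - T * v 3 ^ 2 = 0 := by
      linear_combination e2 / 2 - e3 / 2 - e1
    have f3 : v 2 + w 2 ^ 2 - 2 * T * v 3 * w 3 = 0 := by
      linear_combination e2 / 2 + e3 / 2 - e0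
    rw [f0, f1] at f2 f3
    have h5 : v 2 ^ 5 = T * w 3 ^ 5 :=
      mul_left_cancel₀ hT0 (by linear_combination -v 2 * f2 - w 3 * f3)
    have hw3 : w 3 = 0 := by
      by_contra hw3
      exact hT (v 2 / w 3) (by field_simp; linear_combination h5)
    have hv2 : v 2 = 0 := by simpa [hw3] using h5
    have : q = q 0 • v + q 1 • w := by
      ext i
      fin_cases i <;> simp [v0, v1, w0, w1, hw3, hv2, f0, f1]
      · exact hq.1
      · exact hq.2
    rw [this]
    exact W.add_mem (W.smul_mem _ hv) (W.smul_mem _ hw)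

theorem finrank_span_pair_eq_two {K : Type*} [Field K] {p q : Fin 4 → K} (m n : Fin 4)
    (hpm : p m ≠ 0) (hqm : q m = 0) (hqn : q n ≠ 0) :
    Module.finrank K (Submodule.span K {p, q}) = 2 := by
  have h : LinearIndependent K ![p, q] := by
    refine LinearIndependent.pair_iff.2 fun s t h => ?_
    have hs : s = 0 := by simpa [hqm, hpm] using congrFun h m
    exact ⟨hs, by simpa [hs, hqn] using congrFun h n⟩
  rw [← Matrix.range_cons_cons_empty p q ![], finrank_span_eq_card h, Fintype.card_fin]

theorem eq_span_pair {K : Type*} [Field K] {W : Submodule K (Fin 4 → K)}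
    (hW : Module.finrank K W = 2) {p q : Fin 4 → K} (hp : p ∈ W) (hq : q ∈ W) (m n : Fin 4)
    (hpm : p m ≠ 0) (hqm : q m = 0) (hqn : q n ≠ 0) : W = Submodule.span K {p, q} :=
  (Submodule.eq_of_le_of_finrank_eq
    (Submodule.span_le.2 (Set.insert_subset hp (Set.singleton_subset_iff.2 hq)))
    ((finrank_span_pair_eq_two m n hpm hqm hqn).trans hW.symm)).symm

theorem exists_of_mul_mul_add_eq_zero {K : Type*} [Field K] {x y : K} (h : x ≠ 0 ∨ y ≠ 0)
    (hxy : x * y * (x + y) = 0) :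
    ∃ (i : Fin 3) (c : K), c ≠ 0 ∧ x = c * (![1, 0, 1] : Fin 3 → K) i ∧
      y = c * (![0, 1, -1] : Fin 3 → K) i := by
  rcases mul_eq_zero.1 hxy with hxy | hxy
  · rcases mul_eq_zero.1 hxy with rfl | rfl
    · exact ⟨1, y, by simpa using h, by simp, by simp⟩
    · exact ⟨0, x, by simpa using h, by simp, by simp⟩
  · obtain rfl := eq_neg_of_add_eq_zero_right hxy
    exact ⟨2, x, by simpa using h, by simp, by simp⟩

theorem hasLineCount_nine {K : Type*} [Field K] [CharZero K] {T : K} (hT0 : T ≠ 0)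
    (hT : ∀ x : K, T * x ^ 3 ≠ 1) : HasLineCount K 9 := by
  have hT0' : algebraMap K (AlgebraicClosure K) T ≠ 0 := by simpa using hT0
  have : CharZero (AlgebraicClosure K) := algebraRat.charZero _
  let f : MvPolynomial (Fin 4) K := C 1 * X 0 * X 0 * X 1 + C 1 * X 0 * X 1 * X 1 +
    C (-T) * X 2 * X 2 * X 3 + C (-T) * X 2 * X 3 * X 3
  have hf (v : Fin 4 → K) :
      eval v f = v 0 * v 1 * (v 0 + v 1) - T * (v 2 * v 3 * (v 2 + v 3)) := by
    simp only [f, map_add, map_mul, eval_X, eval_C]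
    ring
  have hf1 : IsSmoothCubic K f := by
    refine ⟨fun h => ?_, ?_, fun x ⟨_, hx⟩ => ?_⟩
    · simpa [h, one_add_one_eq_two] using hf ![1, 1, 0, 0]
    · exact (((isHomogeneous_cubicTerm _ _ _ _).add (isHomogeneous_cubicTerm _ _ _ _)).add
        (isHomogeneous_cubicTerm _ _ _ _)).add (isHomogeneous_cubicTerm _ _ _ _)
    · simp [f, Fin.forall_fin_succ] at hx
      ext i
      fin_cases i <;> simp <;> grind
  let P : Fin 3 → Fin 4 → K := fun i => ![![1, 0, 1] i, ![0, 1, -1] i, 0, 0]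
  let Q : Fin 3 → Fin 4 → K := fun j => ![0, 0, ![1, 0, 1] j, ![0, 1, -1] j]
  let L : Fin 3 × Fin 3 → Submodule K (Fin 4 → K) := fun x => Submodule.span K {P x.1, Q x.2}
  have hspan (W : Submodule K (Fin 4 → K)) (hW : Module.finrank K W = 2) (i j : Fin 3)
      (hi : P i ∈ W) (hj : Q j ∈ W) : W = L (i, j) := by
    refine eq_span_pair hW hi hj (![0, 1, 0] i) (![2, 3, 2] j) ?_ ?_ ?_
    · fin_cases i <;> simp [P]
    · fin_cases i <;> simp [Q]
    · fin_cases j <;> simp [Q]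
  have hrank (x : Fin 3 × Fin 3) : Module.finrank K (L x) = 2 := by
    obtain ⟨i, j⟩ := x
    refine finrank_span_pair_eq_two (![0, 1, 0] i) (![2, 3, 2] j) ?_ ?_ ?_
    · fin_cases i <;> simp [P]
    · fin_cases i <;> simp [Q]
    · fin_cases j <;> simp [Q]
  have hinj : Function.Injective L := by
    intro ⟨i, j⟩ ⟨i', j'⟩ h
    have hP : P i ∈ L (i', j') := h ▸ Submodule.subset_span (by simp)
    have hQ : Q j ∈ L (i', j') := h ▸ Submodule.subset_span (by simp)
    obtain ⟨a, b, hab⟩ := Submodule.mem_span_pair.1 hP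
    obtain ⟨c, d, hcd⟩ := Submodule.mem_span_pair.1 hQ
    have h0 := congrFun hab 0
    have h1 := congrFun hab 1
    have h2 := congrFun hcd 2
    have h3 := congrFun hcd 3
    simp [P, Q] at h0 h1 h2 h3
    rw [Prod.mk.injEq]
    constructor
    · fin_cases i <;> fin_cases i' <;> simp at h0 h1 ⊢ <;> simp_all
    · fin_cases j <;> fin_cases j' <;> simp at h2 h3 ⊢ <;> simp_all
  have := Classical.decEq (Submodule K (Fin 4 → K))
  have hcard : (Finset.univ.image L).card = 9 := by
    rw [Finset.card_image_of_injective _ hinj]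
    rfl
  rw [← hcard]
  refine hasLineCount_of_finset hf1 _ fun W => ?_
  simp only [Finset.mem_image, Finset.mem_univ, true_and]
  refine ⟨?_, fun ⟨hW, h⟩ => ?_⟩
  · rintro ⟨⟨i, j⟩, rfl⟩
    refine ⟨hrank _, fun v hv => ?_⟩
    obtain ⟨a, b, rfl⟩ := Submodule.mem_span_pair.1 hv
    rw [hf]
    fin_cases i <;> fin_cases j <;> simp [P, Q]
  simp only [hf] at h
  rcases exists_ne_zero_or_exists_graph hW 0 1 with
    ⟨p, hp, hp0, p0, p1⟩ | ⟨v, hv, w, hw, v0, v1, w0, w1⟩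
  · have hp23 : p 2 ≠ 0 ∨ p 3 ≠ 0 := by
      by_contra! hp23
      exact hp0 (by ext i; fin_cases i; exacts [p0, p1, hp23.1, hp23.2])
    have hgp : p 2 * p 3 * (p 2 + p 3) = 0 := by simpa [p0, p1, hT0] using h p hp
    obtain ⟨j, c, hc, hc2, hc3⟩ := exists_of_mul_mul_add_eq_zero hp23 hgp
    have hQ : Q j ∈ W := by
      have : p = c • Q j := by
        ext i
        fin_cases i <;> simp [Q, p0, p1, hc2, hc3]
      exact (W.smul_mem_iff hc).1 (this ▸ hp)
    obtain ⟨q, hq, hq0, q2, q3⟩ : ∃ q ∈ W, q ≠ 0 ∧ q 2 = 0 ∧ q 3 = 0 := by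
      have key : ∀ q ∈ W, ∀ t : K, (q 2 + t * p 2) * (q 3 + t * p 3) * (q 2 + t * p 2 +
          (q 3 + t * p 3)) = q 2 * q 3 * (q 2 + q 3) := by
        intro q hq t
        have e0 := h q hq
        have e1 := h _ (W.add_mem hq (W.smul_mem t hp))
        simp only [Pi.add_apply, Pi.smul_apply, smul_eq_mul, p0, p1, mul_zero, add_zero] at e1
        exact mul_left_cancel₀ hT0 (by linear_combination e0 - e1)
      by_cases h2 : p 2 = 0
      · obtain ⟨q, hq, hq0, q3⟩ := exists_ne_zero_apply_eq_zero hW 3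
        have k1 := key q hq 1
        have k2 := key q hq (-1)
        have h3 : p 3 ≠ 0 := by simpa [h2] using hp23
        refine ⟨q, hq, hq0, ?_, q3⟩
        have : p 3 ^ 2 * q 2 = 0 := by
          rw [h2, q3] at k1 k2
          linear_combination k1 / 2 + k2 / 2
        simpa [h3] using this
      · obtain ⟨q, hq, hq0, q2⟩ := exists_ne_zero_apply_eq_zero hW 2
        have k1 := key q hq 1
        have k2 := key q hq (-1)
        refine ⟨q, hq, hq0, q2, ?_⟩
        rw [q2] at k1 k2
        have : p 2 * q 3 ^ 2 = 0 := by linear_combination k1 / 2 - k2 / 2 - hgp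
        simpa [h2] using this
    obtain ⟨i, c', hc', hc0, hc1⟩ := exists_of_mul_mul_add_eq_zero (x := q 0) (y := q 1) (by
      by_contra! h01
      exact hq0 (by ext i; fin_cases i; exacts [h01.1, h01.2, q2, q3]))
      (by simpa [q2, q3] using h q hq)
    have hP : P i ∈ W := by
      have : q = c' • P i := by
        ext i
        fin_cases i <;> simp [P, q2, q3, hc0, hc1]
      exact (W.smul_mem_iff hc').1 (this ▸ hq)
    exact ⟨(i, j), (hspan W hW i j hP hQ).symm⟩
  · exfalso
    have e0 := h v hv
    have e1 := h w hw
    have e2 := h _ (W.add_mem hv hw)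
    have e3 := h _ (W.sub_mem hv hw)
    simp only [Pi.add_apply, Pi.sub_apply, v0, v1, w0, w1] at e0 e1 e2 e3
    generalize v 2 = a at *
    generalize w 2 = b at *
    generalize v 3 = c at *
    generalize w 3 = d at *
    have f0 : a * c * (a + c) = 0 := mul_left_cancel₀ hT0 (by linear_combination -e0)
    have f1 : b * d * (b + d) = 0 := mul_left_cancel₀ hT0 (by linear_combination -e1)
    have f2 : T * (2 * a * b * c + a ^ 2 * d + 2 * a * c * d + b * c ^ 2) = 1 := by
      linear_combination e1 - (e2 - e3) / 2
    have f3 : T * (2 * a * b * d + b ^ 2 * c + 2 * b * c * d + a * d ^ 2) = 1 := by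
      linear_combination e0 - (e2 + e3) / 2
    have hb := hT b
    have hb' := hT (-b)
    have ha := hT a
    have ha' := hT (-a)
    clear e0 e1 e2 e3 hf hT h
    grind

theorem ne_of_nodup {i j l : Fin 4} (h : [i, j, l, 3].Nodup) :
    i ≠ j ∧ i ≠ l ∧ i ≠ 3 ∧ j ≠ i ∧ j ≠ l ∧ j ≠ 3 ∧ l ≠ i ∧ l ≠ j ∧ l ≠ 3 ∧
      3 ≠ i ∧ 3 ≠ j ∧ 3 ≠ l := by
  revert i j l
  decide

theorem forall_fin_four_of_nodup {i j l : Fin 4} (h : [i, j, l, 3].Nodup) {P : Fin 4 → Prop}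
    (hi : P i) (hj : P j) (hl : P l) (h3 : P 3) (m : Fin 4) : P m := by
  have : ∀ i j l : Fin 4, [i, j, l, 3].Nodup → ∀ m, m = i ∨ m = j ∨ m = l ∨ m = 3 := by decide
  rcases this i j l h m with rfl | rfl | rfl | rfl <;> assumption

/-- `(λ, μ, ν)` are the coefficients of a line `x = λ w`, `y = μ z + ν w` on the cubic surface
`x y z + w (a x ^ 2 + b y ^ 2 + c z ^ 2 + d w ^ 2 + w (p x + q y + r z)) = 0`. -/
def IsSlope {K : Type*} [Field K] (a b c d p q r : K) (s : K × K × K) : Prop :=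
  s.1 * s.2.1 + b * s.2.1 ^ 2 + c = 0 ∧ s.1 * s.2.2 + 2 * b * s.2.1 * s.2.2 + q * s.2.1 + r = 0 ∧
    b * s.2.2 ^ 2 + q * s.2.2 + a * s.1 ^ 2 + p * s.1 + d = 0

/-- The line `v i = λ v 3`, `v j = μ v l + ν v 3`. -/
def slopeLine {K : Type*} [Field K] (i j l : Fin 4) (s : K × K × K) : Submodule K (Fin 4 → K) :=
  Submodule.span K {Pi.single j s.2.1 + Pi.single l 1,
    Pi.single i s.1 + Pi.single j s.2.2 + Pi.single 3 1}

theorem mem_slopeLine {K : Type*} [Field K] {i j l : Fin 4} (h : [i, j, l, 3].Nodup)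
    {s : K × K × K} {v : Fin 4 → K} :
    v ∈ slopeLine i j l s ↔ v i = s.1 * v 3 ∧ v j = s.2.1 * v l + s.2.2 * v 3 := by
  have hne := ne_of_nodup h
  rw [slopeLine, Submodule.mem_span_pair]
  constructor
  · rintro ⟨x, y, rfl⟩
    simp [hne]
    constructor <;> ring
  · rintro ⟨hi, hj⟩
    refine ⟨v l, v 3, ?_⟩
    refine funext (forall_fin_four_of_nodup h ?_ ?_ ?_ ?_) <;>
      simp [hne, hi, hj] <;> ring

theorem finrank_slopeLine {K : Type*} [Field K] {i j l : Fin 4} (h : [i, j, l, 3].Nodup)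
    (s : K × K × K) : Module.finrank K (slopeLine i j l s) = 2 := by
  have hne := ne_of_nodup h
  refine finrank_span_pair_eq_two l 3 ?_ ?_ ?_ <;>
    simp [hne]

theorem slopeLine_injective {K : Type*} [Field K] {i j l : Fin 4} (h : [i, j, l, 3].Nodup) :
    Function.Injective (slopeLine (K := K) i j l) := by
  intro s s' hs
  have hp : Pi.single j s.2.1 + Pi.single l 1 ∈ slopeLine i j l s' :=
    hs ▸ Submodule.subset_span (by simp)
  have hq : Pi.single i s.1 + Pi.single j s.2.2 + Pi.single 3 1 ∈ slopeLine i j l s' :=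
    hs ▸ Submodule.subset_span (by simp)
  rw [mem_slopeLine h] at hp hq
  have hne := ne_of_nodup h
  simp [hne] at hp hq
  ext
  exacts [hq.1, hp, hq.2]

theorem IsSlope.eq_zero {K : Type*} [Field K] {a b c d p q r : K} {i j l : Fin 4}
    (h : [i, j, l, 3].Nodup) {s : K × K × K} (hs : IsSlope a b c d p q r s) {v : Fin 4 → K}
    (hv : v ∈ slopeLine i j l s) :
    v i * v j * v l + v 3 * (a * v i ^ 2 + b * v j ^ 2 + c * v l ^ 2 + d * v 3 ^ 2 +
      v 3 * (p * v i + q * v j + r * v l)) = 0 := by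
  obtain ⟨hi, hj⟩ := (mem_slopeLine h).1 hv
  obtain ⟨h1, h2, h3⟩ := hs
  rw [hi, hj]
  linear_combination v 3 * v l ^ 2 * h1 + v 3 ^ 2 * v l * h2 + v 3 ^ 3 * h3

theorem exists_isSlope {K : Type*} [Field K] [CharZero K] {a b c d p q r : K} {i j l : Fin 4}
    (h : [i, j, l, 3].Nodup) (hb : b ≠ 0) {W : Submodule K (Fin 4 → K)}
    (hrank : Module.finrank K W = 2)
    (hW : ∀ v ∈ W, v i * v j * v l + v 3 * (a * v i ^ 2 + b * v j ^ 2 + c * v l ^ 2 + d * v 3 ^ 2 +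
      v 3 * (p * v i + q * v j + r * v l)) = 0)
    {u v : Fin 4 → K} (hu : u ∈ W) (hu0 : u ≠ 0) (hui : u i = 0) (hu3 : u 3 = 0)
    (hv : v ∈ W) (hv3 : v 3 = 1) : ∃ s, IsSlope a b c d p q r s ∧ W = slopeLine i j l s := by
  have key : ∀ x ∈ W, x 3 = 1 → x i * u j * u l + b * u j ^ 2 + c * u l ^ 2 = 0 ∧
      x i * (x j * u l + x l * u j) + 2 * b * x j * u j + 2 * c * x l * u l +
        q * u j + r * u l = 0 := by
    intro x hx hx3
    have e0 := hW x hx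
    have e1 := hW _ (W.add_mem hx hu)
    have e2 := hW _ (W.sub_mem hx hu)
    simp only [Pi.add_apply, Pi.sub_apply, hui, hu3, hx3, add_zero, sub_zero] at e0 e1 e2
    exact ⟨by linear_combination e1 / 2 + e2 / 2 - e0, by linear_combination e1 / 2 - e2 / 2⟩
  have hul : u l ≠ 0 := by
    intro hul
    have huj : u j = 0 := by simpa [hul, hb] using (key v hv hv3).1
    exact hu0 (funext (forall_fin_four_of_nodup h hui huj hul hu3))
  obtain ⟨x, hxW, hx3, hxl⟩ : ∃ x ∈ W, x 3 = 1 ∧ x l = 0 :=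
    ⟨v - (v l / u l) • u, W.sub_mem hv (W.smul_mem _ hu), by simp [hu3, hv3], by simp [hul]⟩
  obtain ⟨k1, k2⟩ := key x hxW hx3
  have k3 := hW x hxW
  rw [hx3, hxl] at k3
  rw [hxl] at k2
  refine ⟨(x i, u j / u l, x j), ⟨?_, ?_, ?_⟩, ?_⟩
  · field_simp
    linear_combination k1
  · field_simp
    linear_combination k2
  · linear_combination k3
  · have hf := (finrank_slopeLine h (x i, u j / u l, x j)).trans hrank.symm
    refine (Submodule.eq_of_le_of_finrank_eq ?_ hf).symm
    intro y hy
    obtain ⟨hyi, hyj⟩ := (mem_slopeLine h).1 hy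
    have : y = (y l / u l) • u + y 3 • x := by
      refine funext (forall_fin_four_of_nodup h ?_ ?_ ?_ ?_) <;>
        simp only [Pi.add_apply, Pi.smul_apply, smul_eq_mul]
      · rw [hui, hyi]
        ring
      · rw [hyj]
        ring
      · rw [hxl]
        field_simp
        ring
      · rw [hu3, hx3]
        ring
    rw [this]
    exact W.add_mem (W.smul_mem _ hu) (W.smul_mem _ hxW)

theorem eq_zero_of_tritangent_gradient {L : Type*} [Field L] [CharZero L]
    {a b c d p x y z w : L} (ha : a ≠ 0) (hb : b ≠ 0) (hc : c ≠ 0) (h₁ : 4 * a * d ≠ p ^ 2)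
    (h₂ : (4 * a * b * c + d) ^ 2 ≠ 4 * b * c * p ^ 2)
    (e0 : y * z + 2 * a * x * w + p * w ^ 2 = 0) (e1 : x * z + 2 * b * y * w = 0)
    (e2 : x * y + 2 * c * z * w = 0)
    (e3 : a * x ^ 2 + b * y ^ 2 + c * z ^ 2 + 3 * d * w ^ 2 + 2 * p * x * w = 0) :
    x = 0 ∧ y = 0 ∧ z = 0 ∧ w = 0 := by
  by_cases hw : w = 0
  · subst hw
    simp only [mul_zero, add_zero, ne_eq, OfNat.ofNat_ne_zero, not_false_eq_true, zero_pow,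
      mul_eq_zero] at e0 e1 e2 e3
    rcases e0 with h | h <;> rcases e1 with h' | h' <;> rcases e2 with h'' | h'' <;> simp_all
  exfalso
  by_cases hz : z = 0
  · have hy : y = 0 := by simpa [hz, hb, hw] using e1
    subst hz hy
    have hx : 2 * a * x + p * w = 0 :=
      (mul_eq_zero.1 (by linear_combination e0 : (2 * a * x + p * w) * w = 0)).resolve_right hw
    refine h₁ (mul_right_cancel₀ (pow_ne_zero 2 hw) ?_)
    linear_combination (4 * a * e3 - (2 * a * x + 3 * p * w) * hx) / 3
  · have hx : x ^ 2 = 4 * b * c * w ^ 2 :=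
      mul_left_cancel₀ hz (by linear_combination x * e1 - 2 * b * w * e2)
    have hyz : b * y ^ 2 = c * z ^ 2 :=
      mul_right_cancel₀ hw (by linear_combination (y * e1 - z * e2) / 2)
    have hz2 : 2 * c * z ^ 2 = 8 * a * b * c * w ^ 2 + p * x * w :=
      mul_right_cancel₀ hw (by linear_combination z * e2 - x * e0 + 2 * a * w * hx)
    have hs : (4 * a * b * c + d) * w = -(p * x) :=
      mul_right_cancel₀ hw (by linear_combination (e3 - a * hx - hyz - hz2) / 3)
    refine h₂ (mul_right_cancel₀ (pow_ne_zero 2 hw) ?_)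
    linear_combination ((4 * a * b * c + d) * w - p * x) * hs + p ^ 2 * hx

theorem isSmoothCubic_tritangent {K : Type*} [Field K] [CharZero K] {a b c d p : K}
    (ha : a ≠ 0) (hb : b ≠ 0) (hc : c ≠ 0) (h₁ : 4 * a * d ≠ p ^ 2)
    (h₂ : (4 * a * b * c + d) ^ 2 ≠ 4 * b * c * p ^ 2) :
    IsSmoothCubic K (C 1 * X 0 * X 1 * X 2 + C a * X 3 * X 0 * X 0 + C b * X 3 * X 1 * X 1 +
      C c * X 3 * X 2 * X 2 + C d * X 3 * X 3 * X 3 + C p * X 3 * X 3 * X 0) := by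
  refine ⟨fun h => ?_, ?_, fun v ⟨_, hv⟩ => ?_⟩
  · simpa using congrArg (eval ![1, 1, 1, 0]) h
  · repeat' apply IsHomogeneous.add
    all_goals exact isHomogeneous_cubicTerm _ _ _ _
  · have : CharZero (AlgebraicClosure K) := algebraRat.charZero _
    have hinj := FaithfulSMul.algebraMap_injective K (AlgebraicClosure K)
    simp [Fin.forall_fin_succ] at hv
    rw [← hinj.ne_iff, map_zero] at ha hb hc
    rw [← hinj.ne_iff] at h₁ h₂
    simp only [map_mul, map_pow, map_add, map_ofNat] at h₁ h₂
    generalize algebraMap K (AlgebraicClosure K) a = a at *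
    generalize algebraMap K (AlgebraicClosure K) b = b at *
    generalize algebraMap K (AlgebraicClosure K) c = c at *
    generalize algebraMap K (AlgebraicClosure K) d = d at *
    generalize algebraMap K (AlgebraicClosure K) p = p at *
    obtain ⟨e0, e1, e2, e3⟩ := hv
    obtain ⟨h0, h1, h2, h3⟩ := eq_zero_of_tritangent_gradient (x := v 0) (y := v 1) (z := v 2)
      (w := v 3) ha hb hc h₁ h₂ (by linear_combination e0) (by linear_combination e1)
      (by linear_combination e2) (by linear_combination e3)
    ext m
    fin_cases m <;> assumption

theorem coordLine_ne_slopeLine {K : Type*} [Field K] {m i j l : Fin 4} (h : [i, j, l, 3].Nodup)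
    (s : K × K × K) : coordLine K m 3 ≠ slopeLine i j l s := by
  intro hs
  have hq : Pi.single i s.1 + Pi.single j s.2.2 + Pi.single 3 1 ∈ coordLine K m 3 :=
    hs ▸ Submodule.subset_span (by simp)
  simpa [ne_of_nodup h] using hq.2

theorem slopeLine_ne_slopeLine {K : Type*} [Field K] {a b c d p q r : K} {i j l : Fin 4}
    (h : [i, j, l, 3].Nodup) (hc : c ≠ 0) {s : K × K × K} (hs : IsSlope a b c d p q r s)
    (s' : K × K × K) : slopeLine i j l s ≠ slopeLine j l i s' := by
  intro hss
  have hp : Pi.single j s.2.1 + Pi.single l 1 ∈ slopeLine j l i s' :=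
    hss ▸ Submodule.subset_span (by simp)
  have h' : [j, l, i, 3].Nodup := by
    have := ne_of_nodup h
    simp [this]
  have hμ : s.2.1 = 0 := by simpa [ne_of_nodup h] using ((mem_slopeLine h').1 hp).1
  exact hc (by simpa [hμ] using hs.1)

theorem finrank_coordLine_three (K : Type*) [Field K] {i : Fin 4} (hi : i ≠ 3) :
    Module.finrank K (coordLine K i 3) = 2 := by
  obtain ⟨m, n, h⟩ : ∃ m n, [i, 3, m, n].Nodup := by
    revert i
    decide
  exact finrank_coordLine K h

theorem mul_mul_eq_zero_of_apply_eq_zero {K : Type*} [Field K] {i : Fin 4} (hi : i ≠ 3)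
    {v : Fin 4 → K} (hv : v i = 0) : v 0 * v 1 * v 2 = 0 := by
  obtain rfl | rfl | rfl : i = 0 ∨ i = 1 ∨ i = 2 := by
    clear hv
    revert i
    decide
  all_goals rw [hv]; ring

theorem eq_coordLine_of_mul_mul_eq_zero {K : Type*} [Field K] [CharZero K]
    {W : Submodule K (Fin 4 → K)} (hrank : Module.finrank K W = 2) (h3 : ∀ v ∈ W, v 3 = 0)
    (h : ∀ v ∈ W, v 0 * v 1 * v 2 = 0) : ∃ i : Fin 4, i ≠ 3 ∧ W = coordLine K i 3 := by
  have key (i : Fin 4) (hi : i ≠ 3) (hW : ∀ v ∈ W, v i = 0) :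
      ∃ i : Fin 4, i ≠ 3 ∧ W = coordLine K i 3 :=
    ⟨i, hi, Submodule.eq_of_le_of_finrank_eq (fun v hv => ⟨hW v hv, h3 v hv⟩)
      (hrank.trans (finrank_coordLine_three K hi).symm)⟩
  by_cases h0 : ∀ v ∈ W, v 0 = 0
  · exact key 0 (by decide) h0
  push Not at h0
  obtain ⟨q, hq, hq0⟩ := h0
  obtain ⟨p, hp, hp0, hp0'⟩ := exists_ne_zero_apply_eq_zero hrank 0
  have e0 := h q hq
  have e1 := h _ (W.add_mem hq hp)
  have e2 := h _ (W.sub_mem hq hp)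
  simp only [Pi.add_apply, Pi.sub_apply, hp0', add_zero, sub_zero] at e0 e1 e2
  have f1 : q 1 * p 2 + q 2 * p 1 = 0 :=
    mul_left_cancel₀ hq0 (by linear_combination (e1 - e2) / 2)
  have f2 : p 1 * p 2 = 0 := mul_left_cancel₀ hq0 (by linear_combination (e1 + e2) / 2 - e0)
  have hspan (m n : Fin 4) (hpn : p n ≠ 0) (hpm : p m = 0) (hqm : q m = 0) (v : Fin 4 → K)
      (hv : v ∈ W) : v m = 0 := by
    rw [eq_span_pair hrank hq hp 0 n hq0 hp0' hpn] at hv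
    obtain ⟨s, t, rfl⟩ := Submodule.mem_span_pair.1 hv
    simp [hpm, hqm]
  have hp12 : ¬ (p 1 = 0 ∧ p 2 = 0) := fun h12 => hp0 (by
    ext m
    fin_cases m
    exacts [hp0', h12.1, h12.2, h3 p hp])
  rcases mul_eq_zero.1 f2 with hp1 | hp2
  · have hp2 : p 2 ≠ 0 := fun hp2 => hp12 ⟨hp1, hp2⟩
    exact key 1 (by decide) (hspan 1 2 hp2 hp1 (by simpa [hp1, hp2] using f1))
  · have hp1 : p 1 ≠ 0 := fun hp1 => hp12 ⟨hp1, hp2⟩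
    exact key 2 (by decide) (hspan 2 1 hp1 hp2 (by simpa [hp1, hp2] using f1))

theorem hasLineCount_tritangent {K : Type*} [Field K] [CharZero K] {a b c d p : K}
    (ha : a ≠ 0) (hb : b ≠ 0) (hc : c ≠ 0) (h₁ : 4 * a * d ≠ p ^ 2)
    (h₂ : (4 * a * b * c + d) ^ 2 ≠ 4 * b * c * p ^ 2) (Sx Sy Sz : Finset (K × K × K))
    (hx : ∀ s, s ∈ Sx ↔ IsSlope a b c d p 0 0 s) (hy : ∀ s, s ∈ Sy ↔ IsSlope b c a d 0 0 p s)
    (hz : ∀ s, s ∈ Sz ↔ IsSlope c a b d 0 p 0 s) :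
    HasLineCount K (3 + Sx.card + Sy.card + Sz.card) := by
  classical
  have hf (v : Fin 4 → K) :
      eval v (C 1 * X 0 * X 1 * X 2 + C a * X 3 * X 0 * X 0 + C b * X 3 * X 1 * X 1 +
        C c * X 3 * X 2 * X 2 + C d * X 3 * X 3 * X 3 + C p * X 3 * X 3 * X 0) =
      v 0 * v 1 * v 2 + v 3 * (a * v 0 ^ 2 + b * v 1 ^ 2 + c * v 2 ^ 2 + d * v 3 ^ 2 +
        v 3 * (p * v 0)) := by
    simp only [map_add, map_mul, eval_X, eval_C]
    ring
  have h012 : [(0 : Fin 4), 1, 2, 3].Nodup := by decide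
  have h120 : [(1 : Fin 4), 2, 0, 3].Nodup := by decide
  have h201 : [(2 : Fin 4), 0, 1, 3].Nodup := by decide
  have hinj : ∀ i j : Fin 4, i ≠ 3 → coordLine K i 3 = coordLine K j 3 → i = j := by
    intro i j hi hij
    by_contra hne
    have hmem : Pi.single i 1 ∈ coordLine K j 3 := by simp [mem_coordLine, hne, hi]
    rw [← hij] at hmem
    simpa using hmem.1
  have hcard : ((Finset.univ.erase 3).image (coordLine K · 3) ∪
      Sx.image (slopeLine 0 1 2) ∪ Sy.image (slopeLine 1 2 0) ∪ Sz.image (slopeLine 2 0 1)).card =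
      3 + Sx.card + Sy.card + Sz.card := by
    rw [Finset.card_union_of_disjoint, Finset.card_union_of_disjoint,
      Finset.card_union_of_disjoint, Finset.card_image_of_injective _ (slopeLine_injective h012),
      Finset.card_image_of_injective _ (slopeLine_injective h120),
      Finset.card_image_of_injective _ (slopeLine_injective h201), Finset.card_image_of_injOn]
    · rfl
    · intro i hi j hj
      exact hinj i j (Finset.ne_of_mem_erase hi)
    all_goals
      simp only [Finset.disjoint_left, Finset.mem_union, Finset.mem_image, not_exists, not_and]
    · rintro _ ⟨i, -, rfl⟩ s - h
      exact coordLine_ne_slopeLine h012 s h.symm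
    · rintro _ (⟨i, -, rfl⟩ | ⟨s, hs, rfl⟩) s' hs' h
      · exact coordLine_ne_slopeLine h120 s' h.symm
      · exact slopeLine_ne_slopeLine h012 hc ((hx s).1 hs) s' h.symm
    · rintro _ ((⟨i, -, rfl⟩ | ⟨s, hs, rfl⟩) | ⟨s, hs, rfl⟩) s' hs' h
      · exact coordLine_ne_slopeLine h201 s' h.symm
      · exact slopeLine_ne_slopeLine h201 hb ((hz s').1 hs') s h
      · exact slopeLine_ne_slopeLine h120 ha ((hy s).1 hs) s' h.symm
  rw [← hcard]
  refine hasLineCount_of_finset (isSmoothCubic_tritangent ha hb hc h₁ h₂) _ fun W => ?_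
  simp only [hf, Finset.mem_union, Finset.mem_image]
  constructor
  · rintro (((⟨i, hi, rfl⟩ | ⟨s, hs, rfl⟩) | ⟨s, hs, rfl⟩) | ⟨s, hs, rfl⟩)
    · refine ⟨finrank_coordLine_three K (Finset.ne_of_mem_erase hi), fun v hv => ?_⟩
      rw [mem_coordLine] at hv
      rw [mul_mul_eq_zero_of_apply_eq_zero (Finset.ne_of_mem_erase hi) hv.1, hv.2]
      ring
    · refine ⟨finrank_slopeLine h012 s, fun v hv => ?_⟩
      linear_combination ((hx s).1 hs).eq_zero h012 hv
    · refine ⟨finrank_slopeLine h120 s, fun v hv => ?_⟩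
      linear_combination ((hy s).1 hs).eq_zero h120 hv
    · refine ⟨finrank_slopeLine h201 s, fun v hv => ?_⟩
      linear_combination ((hz s).1 hs).eq_zero h201 hv
  rintro ⟨hW, h⟩
  by_cases h3 : ∀ v ∈ W, v 3 = 0
  · obtain ⟨i, hi, rfl⟩ := eq_coordLine_of_mul_mul_eq_zero hW h3
      fun v hv => by simpa [h3 v hv] using h v hv
    exact Or.inl (Or.inl (Or.inl ⟨i, Finset.mem_erase_of_ne_of_mem hi (Finset.mem_univ i), rfl⟩))
  push Not at h3
  obtain ⟨v, hv, hv3⟩ := h3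
  have hv' : (v 3)⁻¹ • v ∈ W := W.smul_mem _ hv
  have hv3' : ((v 3)⁻¹ • v) 3 = 1 := by simp [hv3]
  obtain ⟨u, hu, hu0, hu3⟩ := exists_ne_zero_apply_eq_zero hW 3
  have hu012 : u 0 * u 1 * u 2 = 0 := by simpa [hu3] using h u hu
  simp only [mul_eq_zero, or_assoc] at hu012
  rcases hu012 with hu' | hu' | hu'
  · obtain ⟨s, hs, rfl⟩ := exists_isSlope (a := a) (b := b) (c := c) (d := d) (p := p) (q := 0)
      (r := 0) h012 hb hW (fun v hv => by linear_combination h v hv) hu hu0 hu' hu3 hv' hv3'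
    exact Or.inl (Or.inl (Or.inr ⟨s, (hx s).2 hs, rfl⟩))
  · obtain ⟨s, hs, rfl⟩ := exists_isSlope (a := b) (b := c) (c := a) (d := d) (p := 0) (q := 0)
      (r := p) h120 hc hW (fun v hv => by linear_combination h v hv) hu hu0 hu' hu3 hv' hv3'
    exact Or.inl (Or.inr ⟨s, (hy s).2 hs, rfl⟩)
  · obtain ⟨s, hs, rfl⟩ := exists_isSlope (a := c) (b := a) (c := b) (d := d) (p := 0) (q := p)
      (r := 0) h201 ha hW (fun v hv => by linear_combination h v hv) hu hu0 hu' hu3 hv' hv3'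
    exact Or.inr ⟨s, (hz s).2 hs, rfl⟩

theorem isSlope_zero_iff {K : Type*} [Field K] {a b c d : K} {s : K × K × K} :
    IsSlope a b c d 0 0 0 s ↔
      (s.2.2 = 0 ∧ s.1 * s.2.1 + b * s.2.1 ^ 2 + c = 0 ∧ a * s.1 ^ 2 + d = 0) ∨
      (s.2.2 ≠ 0 ∧ s.1 = -2 * b * s.2.1 ∧ b * s.2.1 ^ 2 = c ∧
        b * s.2.2 ^ 2 = -(4 * a * b * c + d)) := by
  obtain ⟨x, y, z⟩ := s
  simp only [IsSlope]
  constructor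
  · rintro ⟨h1, h2, h3⟩
    by_cases hz : z = 0
    · subst hz
      exact Or.inl ⟨rfl, h1, by linear_combination h3⟩
    · have hx : x = -2 * b * y := mul_right_cancel₀ hz (by linear_combination h2)
      subst hx
      have hc : b * y ^ 2 = c := by linear_combination -h1
      exact Or.inr ⟨hz, rfl, hc, by linear_combination h3 - 4 * a * b * hc⟩
  · rintro (⟨rfl, h1, h2⟩ | ⟨-, rfl, h1, h2⟩)
    · exact ⟨h1, by ring, by linear_combination h2⟩
    · exact ⟨by linear_combination -h1, by ring, by linear_combination h2 + 4 * a * b * h1⟩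

theorem hasLineCount_three {K : Type*} [Field K] [CharZero K] {T : K} (hT : ¬ IsSquare T)
    (hT4 : ¬ IsSquare (T - 4)) : HasLineCount K 3 := by
  have h (s : K × K × K) : s ∈ (∅ : Finset (K × K × K)) ↔ IsSlope 1 1 1 (-T) 0 0 0 s := by
    rw [isSlope_zero_iff]
    refine iff_of_false (Finset.notMem_empty s) ?_
    rintro (⟨-, -, h⟩ | ⟨-, -, -, h⟩)
    · exact hT ⟨s.1, by linear_combination -h⟩
    · exact hT4 ⟨s.2.2, by linear_combination -h⟩
  refine hasLineCount_tritangent one_ne_zero one_ne_zero one_ne_zero ?_ ?_ ∅ ∅ ∅ h h h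
  · rintro h
    exact hT ⟨0, by linear_combination -h / 4⟩
  · intro h
    rw [zero_pow two_ne_zero, mul_zero, sq_eq_zero_iff] at h
    exact hT4 ⟨0, by linear_combination -h⟩

theorem exists_finset_card_four {K : Type*} [Field K] [CharZero K] {t : K} (ht : t ≠ 0) :
    ∃ S : Finset (K × K × K), S.card = 4 ∧
      ∀ s, s ∈ S ↔ s.1 = -2 * s.2.1 ∧ s.2.1 ^ 2 = 1 ∧ s.2.2 ^ 2 = t ^ 2 := by
  classical
  have ht' : t ≠ -t := fun h => ht (self_eq_neg.1 h)
  have h1 : (1 : K) ≠ -1 := fun h => one_ne_zero (self_eq_neg.1 h)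
  refine ⟨{(-2, 1, t), (-2, 1, -t), (2, -1, t), (2, -1, -t)}, ?_, fun ⟨x, y, z⟩ => ?_⟩
  · simp [Finset.card_insert_of_notMem, ht', h1]
  · simp only [Finset.mem_insert, Finset.mem_singleton, Prod.mk.injEq,
      sq_eq_sq_iff_eq_or_eq_neg, sq_eq_one_iff]
    grind

theorem hasLineCount_seven {K : Type*} [Field K] [CharZero K] {T : K} (hT : ¬ IsSquare T)
    (hT1 : ¬ IsSquare (1 + 4 * T)) (hT2 : ¬ IsSquare (T * (1 + 4 * T))) : HasLineCount K 7 := by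
  have hT0 : T ≠ 0 := by rintro rfl; simp at hT
  obtain ⟨S, hS, hmem⟩ := exists_finset_card_four (one_ne_zero (α := K))
  rw [show 7 = 3 + (∅ : Finset (K × K × K)).card + (∅ : Finset (K × K × K)).card + S.card by
    simp [hS]]
  refine hasLineCount_tritangent (a := 1) (b := 1) (c := T) (d := -(1 + 4 * T)) (p := 0)
    one_ne_zero one_ne_zero hT0 ?_ ?_ ∅ ∅ S ?_ ?_ ?_
  · rintro h
    exact hT1 ⟨0, by linear_combination -h / 4⟩
  · ring_nf
    exact one_ne_zero
  all_goals
    intro s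
    rw [isSlope_zero_iff]
  · refine iff_of_false (Finset.notMem_empty s) ?_
    rintro (⟨-, -, h⟩ | ⟨-, -, h, -⟩)
    · exact hT1 ⟨s.1, by linear_combination -h⟩
    · exact hT ⟨s.2.1, by linear_combination -h⟩
  · refine iff_of_false (Finset.notMem_empty s) ?_
    rintro (⟨-, -, h⟩ | ⟨-, -, h, -⟩)
    · exact hT1 ⟨s.1, by linear_combination -h⟩
    · exact hT ⟨T * s.2.1, by linear_combination -T * h⟩
  · rw [hmem]
    constructor
    · rintro ⟨h1, h2, h3⟩
      refine Or.inr ⟨?_, by linear_combination h1, by linear_combination h2,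
        by linear_combination h3⟩
      rintro h
      simp [h] at h3
    · rintro (⟨-, -, h⟩ | ⟨-, h1, h2, h3⟩)
      · exact absurd ⟨T * s.1, by linear_combination -T * h⟩ hT2
      · exact ⟨by linear_combination h1, by linear_combination h2, by linear_combination h3⟩

theorem hasLineCount_fifteen {K : Type*} [Field K] [CharZero K] {T : K} (hT0 : T ≠ 0)
    (hT : ¬ IsSquare (T ^ 2 + 4)) : HasLineCount K 15 := by
  obtain ⟨S, hS, hmem⟩ := exists_finset_card_four hT0
  have h (s : K × K × K) : s ∈ S ↔ IsSlope 1 1 1 (-(T ^ 2 + 4)) 0 0 0 s := by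
    rw [isSlope_zero_iff, hmem]
    constructor
    · rintro ⟨h1, h2, h3⟩
      refine Or.inr ⟨?_, by linear_combination h1, by linear_combination h2,
        by linear_combination h3⟩
      rintro h
      rw [h, zero_pow two_ne_zero] at h3
      exact pow_ne_zero 2 hT0 h3.symm
    · rintro (⟨-, -, h⟩ | ⟨-, h1, h2, h3⟩)
      · exact absurd ⟨s.1, by linear_combination -h⟩ hT
      · exact ⟨by linear_combination h1, by linear_combination h2, by linear_combination h3⟩
  rw [show 15 = 3 + S.card + S.card + S.card by rw [hS]]
  refine hasLineCount_tritangent one_ne_zero one_ne_zero one_ne_zero ?_ ?_ S S S h h h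
  · rintro h
    exact hT ⟨0, by linear_combination -h / 4⟩
  · ring_nf
    simpa using hT0

theorem hasLineCount_twentySeven (K : Type*) [Field K] [CharZero K] : HasLineCount K 27 := by
  classical
  obtain ⟨S, hS, hmem⟩ := exists_finset_card_four (t := (3 / 2 : K)) (by norm_num)
  let S' : Finset (K × K × K) :=
    {(5 / 2, -2, 0), (5 / 2, -1 / 2, 0), (-5 / 2, 2, 0), (-5 / 2, 1 / 2, 0)}
  have hS' : S'.card = 4 := by
    norm_num [S', Finset.card_insert_of_notMem]
  have hdisj : Disjoint S S' := by
    rw [Finset.disjoint_left]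
    intro s hs hs'
    have h0 : s.2.2 = 0 := by
      simp only [S', Finset.mem_insert, Finset.mem_singleton] at hs'
      rcases hs' with rfl | rfl | rfl | rfl <;> rfl
    have := ((hmem s).1 hs).2.2
    norm_num [h0] at this
  have h (s : K × K × K) : s ∈ S ∪ S' ↔ IsSlope 1 1 1 (-25 / 4) 0 0 0 s := by
    rw [isSlope_zero_iff, Finset.mem_union, hmem, or_comm]
    refine or_congr ?_ ?_
    · obtain ⟨x, y, z⟩ := s
      simp only [S', Finset.mem_insert, Finset.mem_singleton, Prod.mk.injEq]
      constructor
      · rintro (⟨rfl, rfl, rfl⟩ | ⟨rfl, rfl, rfl⟩ | ⟨rfl, rfl, rfl⟩ | ⟨rfl, rfl, rfl⟩) <;>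
          norm_num
      · rintro ⟨rfl, h1, h2⟩
        have hx : (x - 5 / 2) * (x + 5 / 2) = 0 := by linear_combination h2
        rcases mul_eq_zero.1 hx with hx | hx
        · have hy : (y + 2) * (y + 1 / 2) = 0 := by linear_combination h1 - y * hx
          rcases mul_eq_zero.1 hy with hy | hy
          · exact Or.inl ⟨by linear_combination hx, by linear_combination hy, rfl⟩
          · exact Or.inr (Or.inl ⟨by linear_combination hx, by linear_combination hy, rfl⟩)
        · have hy : (y - 2) * (y - 1 / 2) = 0 := by linear_combination h1 - y * hx
          rcases mul_eq_zero.1 hy with hy | hy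
          · exact Or.inr (Or.inr (Or.inl
              ⟨by linear_combination hx, by linear_combination hy, rfl⟩))
          · exact Or.inr (Or.inr (Or.inr
              ⟨by linear_combination hx, by linear_combination hy, rfl⟩))
    · constructor
      · rintro ⟨h1, h2, h3⟩
        refine ⟨?_, by linear_combination h1, by linear_combination h2, by linear_combination h3⟩
        rintro h
        norm_num [h] at h3
      · rintro ⟨-, h1, h2, h3⟩
        exact ⟨by linear_combination h1, by linear_combination h2, by linear_combination h3⟩
  rw [show 27 = 3 + (S ∪ S').card + (S ∪ S').card + (S ∪ S').card by
    rw [Finset.card_union_of_disjoint hdisj, hS, hS']]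
  refine hasLineCount_tritangent one_ne_zero one_ne_zero one_ne_zero ?_ ?_ _ _ _ h h h <;>
    norm_num

theorem hasLineCount_five {K : Type*} [Field K] [CharZero K] {T : K} (hT : ¬ IsSquare T)
    (hT' : ¬ IsSquare (1 - 4 * T)) : HasLineCount K 5 := by
  classical
  have hT0 : T ≠ 0 := by rintro rfl; simp at hT
  have hy (s : K × K × K) : ¬ IsSlope 1 1 (-T / 16) (-(2 + T) / 4) 0 0 ((T - 1) / 4) s := by
    obtain ⟨x, y, z⟩ := s
    rintro ⟨h1, h2, h3⟩
    simp only at h1 h2 h3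
    refine hT ⟨2 * x ^ 2 - (2 + T) / 4 + T / 4, ?_⟩
    linear_combination -4 * (x ^ 2 + T / 4) * h3 - 16 * z ^ 2 * h1 -
      4 * ((T - 1) / 4 - z * (x + 2 * y)) * h2
  let S : Finset (K × K × K) := {(2, -1, 1), (2, -1, -1)}
  have hS : S.card = 2 := by
    have h1 : (1 : K) ≠ -1 := fun h => one_ne_zero (self_eq_neg.1 h)
    simp [S, Finset.card_insert_of_notMem, h1]
  rw [show 5 = 3 + S.card + (∅ : Finset (K × K × K)).card + (∅ : Finset (K × K × K)).card by
    simp [hS]]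
  refine hasLineCount_tritangent (a := -T / 16) (b := 1) (c := 1) (d := -(2 + T) / 4)
    (p := (T - 1) / 4) (by simpa) one_ne_zero one_ne_zero ?_ ?_ S ∅ ∅ ?_ ?_ ?_
  · intro h
    exact hT' ⟨0, by linear_combination -16 * h⟩
  · intro h
    exact hT0 (by linear_combination h)
  · rintro ⟨x, y, z⟩
    simp only [S, Finset.mem_insert, Finset.mem_singleton, Prod.mk.injEq]
    constructor
    · rintro (⟨rfl, rfl, rfl⟩ | ⟨rfl, rfl, rfl⟩) <;> refine ⟨?_, ?_, ?_⟩ <;> ring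
    · rintro ⟨h1, h2, h3⟩
      simp only at h1 h2 h3
      have hz : z ≠ 0 := by
        rintro rfl
        exact hT' ⟨T / 2 * x - (T - 1), by linear_combination 4 * T * h3⟩
      have hx : x = -2 * y := mul_right_cancel₀ hz (by linear_combination h2)
      subst hx
      have hy : y = -1 := by
        have hy : (y - 1) * (y + 1) = 0 := by linear_combination -h1
        refine eq_neg_of_add_eq_zero_left ((mul_eq_zero.1 hy).resolve_left fun hy => hT ⟨z, ?_⟩)
        obtain rfl : y = 1 := by linear_combination hy
        linear_combination -h3
      subst hy
      have hz : (z - 1) * (z + 1) = 0 := by linear_combination h3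
      rcases mul_eq_zero.1 hz with hz | hz
      · exact Or.inl ⟨by ring, rfl, by linear_combination hz⟩
      · exact Or.inr ⟨by ring, rfl, by linear_combination hz⟩
  · exact fun s => iff_of_false (Finset.notMem_empty s) (hy s)
  · refine fun ⟨x, y, z⟩ => iff_of_false (Finset.notMem_empty _) fun ⟨h1, h2, h3⟩ => ?_
    simp only at h1 h2 h3
    obtain ⟨m, hm⟩ : ∃ m, y * m = 1 := by
      refine ⟨y⁻¹, mul_inv_cancel₀ ?_⟩
      rintro rfl
      simp at h1
    have e1 : x * m + m ^ 2 + -T / 16 = 0 := by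
      linear_combination m ^ 2 * h1 - (x * m + -T / 16 * (y * m + 1)) * hm
    have e2 : x * (-z * m) + 2 * m * (-z * m) + (T - 1) / 4 = 0 := by
      linear_combination m * h2 - 2 * z * e1 - (2 * (-T / 16) * z + (T - 1) / 4) * hm
    exact hy (x, m, -z * m) ⟨by linear_combination e1, by linear_combination e2,
      by linear_combination h3 - z ^ 2 * e1 - z * e2⟩

theorem RatFunc.not_isSquare_quadratic {k : Type*} [Field k] {a b c : k} (h : discrim a b c ≠ 0) :
    ¬ IsSquare (RatFunc.C a * RatFunc.X ^ 2 + RatFunc.C b * RatFunc.X + RatFunc.C c) := by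
  rintro ⟨r, hr⟩
  set p : Polynomial k :=
    Polynomial.C a * Polynomial.X ^ 2 + Polynomial.C b * Polynomial.X + Polynomial.C c with hp
  have hpr : algebraMap (Polynomial k) (RatFunc k) p = r * r := by simp [hp, ← hr]
  obtain ⟨q, rfl⟩ : ∃ q, algebraMap (Polynomial k) (RatFunc k) q = r := by
    refine IsIntegrallyClosed.isIntegral_iff.1 (IsIntegral.of_pow two_pos ?_)
    rw [sq, ← hpr]
    exact isIntegral_algebraMap
  rw [← map_mul] at hpr
  have hpq := RatFunc.algebraMap_injective k hpr
  have hd : p.derivative ^ 2 - 4 * Polynomial.C a * p = Polynomial.C (discrim a b c) := by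
    simp only [hp, discrim, Polynomial.derivative_add, Polynomial.derivative_C_mul_X_sq,
      Polynomial.derivative_C_mul_X, Polynomial.derivative_C, map_sub, map_mul, map_pow,
      map_ofNat]
    ring
  have hq : IsUnit q := by
    refine isUnit_of_dvd_unit ⟨4 * q * q.derivative ^ 2 - 4 * Polynomial.C a * q, ?_⟩
      (Polynomial.isUnit_C.2 h.isUnit)
    rw [← hd, hpq, Polynomial.derivative_mul]
    ring
  have hp0 := Polynomial.natDegree_eq_zero_of_isUnit (hpq ▸ hq.mul hq)
  have ha : p.coeff 2 = 0 := Polynomial.coeff_eq_zero_of_natDegree_lt (by omega)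
  have hb : p.coeff 1 = 0 := Polynomial.coeff_eq_zero_of_natDegree_lt (by omega)
  simp [hp, Polynomial.coeff_C] at ha hb
  simp [discrim, ha, hb] at h

theorem RatFunc.charZero (k : Type*) [Field k] [CharZero k] : CharZero (RatFunc k) :=
  charZero_of_injective_algebraMap (algebraMap k (RatFunc k)).injective

theorem RatFunc.intDegree_pow {k : Type*} [Field k] {x : RatFunc k} (hx : x ≠ 0) (n : ℕ) :
    (x ^ n).intDegree = n * x.intDegree := by
  induction n with
  | zero => simp
  | succ n ih =>
    rw [pow_succ, RatFunc.intDegree_mul (pow_ne_zero n hx) hx, ih]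
    push_cast
    ring

theorem RatFunc.X_mul_pow_three_ne_one {k : Type*} [Field k] (x : RatFunc k) :
    RatFunc.X * x ^ 3 ≠ 1 := by
  intro h
  have hx : x ≠ 0 := by
    rintro rfl
    simp at h
  have := congrArg RatFunc.intDegree h
  rw [RatFunc.intDegree_mul RatFunc.X_ne_zero (pow_ne_zero 3 hx), RatFunc.intDegree_pow hx,
    RatFunc.intDegree_X, RatFunc.intDegree_one] at this
  omega

theorem RatFunc.pow_five_ne_X {k : Type*} [Field k] (x : RatFunc k) : x ^ 5 ≠ RatFunc.X := by
  intro h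
  have hx : x ≠ 0 := by
    rintro rfl
    simp [RatFunc.X_ne_zero.symm] at h
  have := congrArg RatFunc.intDegree h
  rw [RatFunc.intDegree_pow hx, RatFunc.intDegree_X] at this
  omega

theorem RatFunc.eq_zero_of_add_add_eq_zero {k : Type*} [Field k] {u v w : RatFunc k}
    (huv : u ≠ 0 → v ≠ 0 → u.intDegree ≠ v.intDegree)
    (hvw : v ≠ 0 → w ≠ 0 → v.intDegree ≠ w.intDegree)
    (huw : u ≠ 0 → w ≠ 0 → u.intDegree ≠ w.intDegree) (h : u + v + w = 0) :
    u = 0 ∧ v = 0 ∧ w = 0 := by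
  have hu : u = -(v + w) := by linear_combination h
  have hv : v = -(u + w) := by linear_combination h
  have hw : w = -(u + v) := by linear_combination h
  have du : u.intDegree = (v + w).intDegree := by rw [hu, RatFunc.intDegree_neg]
  have dv : v.intDegree = (u + w).intDegree := by rw [hv, RatFunc.intDegree_neg]
  have dw : w.intDegree = (u + v).intDegree := by rw [hw, RatFunc.intDegree_neg]
  by_cases hu0 : u = 0
  · by_cases hw0 : w = 0
    · exact ⟨hu0, by simpa [hu0, hw0] using hv, hw0⟩
    · refine absurd ?_ (hvw (by simpa [hv, hu0]) hw0)
      rw [dv, hu0, zero_add]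
  · by_cases hv0 : v = 0
    · refine absurd ?_ (huw hu0 (by simpa [hw, hv0]))
      rw [du, hv0, zero_add]
    · by_cases hw0 : w = 0
      · refine absurd ?_ (huv hu0 hv0)
        rw [du, hw0, add_zero]
      have l1 := RatFunc.intDegree_add_le hw0 (x := v) (fun h => hu0 (by simpa [h] using hu))
      have l2 := RatFunc.intDegree_add_le hw0 (x := u) (fun h => hv0 (by simpa [h] using hv))
      have l3 := RatFunc.intDegree_add_le hv0 (x := u) (fun h => hw0 (by simpa [h] using hw))
      have := huv hu0 hv0
      have := hvw hv0 hw0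
      have := huw hu0 hw0
      omega

theorem RatFunc.eq_zero_of_pow_three_add {k : Type*} [Field k] (x y z : RatFunc k)
    (h : x ^ 3 + RatFunc.X * y ^ 3 + RatFunc.X ^ 2 * z ^ 3 = 0) : x = 0 ∧ y = 0 ∧ z = 0 := by
  have hX := RatFunc.X_ne_zero (K := k)
  have dx (hx : x ≠ 0) : (x ^ 3).intDegree = 3 * x.intDegree := RatFunc.intDegree_pow hx 3
  have dy (hy : y ≠ 0) : (RatFunc.X * y ^ 3).intDegree = 1 + 3 * y.intDegree := by
    rw [RatFunc.intDegree_mul hX (pow_ne_zero 3 hy), RatFunc.intDegree_X,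
      RatFunc.intDegree_pow hy]
    rfl
  have dz (hz : z ≠ 0) : (RatFunc.X ^ 2 * z ^ 3).intDegree = 2 + 3 * z.intDegree := by
    rw [RatFunc.intDegree_mul (pow_ne_zero 2 hX) (pow_ne_zero 3 hz), RatFunc.intDegree_pow hX,
      RatFunc.intDegree_X, RatFunc.intDegree_pow hz]
    rfl
  have := RatFunc.eq_zero_of_add_add_eq_zero ?_ ?_ ?_ h
  · simpa [hX] using this
  · intro hx hy
    rw [dx (by rintro rfl; simp at hx), dy (by rintro rfl; simp at hy)]
    omega
  · intro hy hz
    rw [dy (by rintro rfl; simp at hy), dz (by rintro rfl; simp at hz)]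
    omega
  · intro hx hz
    rw [dx (by rintro rfl; simp at hx), dz (by rintro rfl; simp at hz)]
    omega

/-- each count in {0,1,2,3,5,7,9,15,27} is realized by a smooth cubic
surface over the rational function field `k(z)` for any characteristic-zero field `k`. -/
theorem exists_smooth_cubic_ratfunc_with_line_count
    (k : Type*) [Field k] [CharZero k] :
    ∀ n ∈ ({0, 1, 2, 3, 5, 7, 9, 15, 27} : Set ℕ),
      ∃ f : MvPolynomial (Fin 4) (RatFunc k), IsSmoothCubic (RatFunc k) f ∧
        {W : Submodule (RatFunc k) (Fin 4 → RatFunc k) | IsLineOn f W}.Finite ∧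
        {W : Submodule (RatFunc k) (Fin 4 → RatFunc k) | IsLineOn f W}.ncard = n := by
  intro n hn
  change HasLineCount (RatFunc k) n
  have := RatFunc.charZero k
  have hX := RatFunc.X_ne_zero (K := k)
  have quad (a b c : k) (h : discrim a b c ≠ 0) {r : RatFunc k}
      (hr : RatFunc.C a * RatFunc.X ^ 2 + RatFunc.C b * RatFunc.X + RatFunc.C c = r) :
      ¬ IsSquare r := hr ▸ RatFunc.not_isSquare_quadratic h
  have hXsq : ¬ IsSquare (RatFunc.X : RatFunc k) :=
    quad 0 1 0 (by norm_num [discrim]) (by simp)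
  simp only [Set.mem_insert_iff, Set.mem_singleton_iff] at hn
  rcases hn with rfl | rfl | rfl | rfl | rfl | rfl | rfl | rfl | rfl
  · exact hasLineCount_zero RatFunc.eq_zero_of_pow_three_add
  · exact hasLineCount_one (u := RatFunc.X + 1) hXsq
      (quad 0 1 1 (by norm_num [discrim]) (by simp))
      (quad 1 1 0 (by norm_num [discrim]) (by simp only [map_one, map_zero]; ring))
  · exact hasLineCount_two hX RatFunc.pow_five_ne_X
  · exact hasLineCount_three hXsq
      (quad 0 1 (-4) (by norm_num [discrim])
        (by simp only [map_one, map_zero, map_neg, map_ofNat]; ring))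
  · exact hasLineCount_five hXsq
      (quad 0 (-4) 1 (by norm_num [discrim])
        (by simp only [map_one, map_zero, map_neg, map_ofNat]; ring))
  · exact hasLineCount_seven hXsq
      (quad 0 4 1 (by norm_num [discrim]) (by simp only [map_one, map_zero, map_ofNat]; ring))
      (quad 4 1 0 (by norm_num [discrim]) (by simp only [map_one, map_zero, map_ofNat]; ring))
  · exact hasLineCount_nine hX RatFunc.X_mul_pow_three_ne_one
  · exact hasLineCount_fifteen hX
      (quad 1 0 4 (by norm_num [discrim]) (by simp only [map_one, map_zero, map_ofNat]; ring))
  · exact hasLineCount_twentySeven (RatFunc k)
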